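/- Let q be an odd prime power and Z ⊆ F_q^2 a finite set. Writing S_ψ(Z) = Σ_{u,v,w ∈ Z} ψ(Δ(u,v,w)) for an additive character ψ of F_q, the sum R = Σ_{ψ nontrivial} |S_ψ(Z)| over all nontrivial additive characters ψ of F_q satisfies R^2 ≤ 2·(#Z)^3·q^5, i.e. R ≤ √2 · (#Z)^{3/2} · q^{5/2}. -/

import Mathlib

open Finset

/-- `Δ(u,v,w) = Σ_i ((u_i−v_i)² + (u_i−w_i)² − (v_i−w_i)²)`. -/
def delta {F : Type*} [Field F] {n : ℕ} (u v w : Fin n → F) : F :=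
  ∑ i, ((u i - v i) ^ 2 + (u i - w i) ^ 2 - (v i - w i) ^ 2)

section

variable {F : Type*} [Field F]

/-- The difference of two values of `delta u` is an affine function of `u`. -/
lemma delta_sub_delta (u v w v' w' : Fin 2 → F) :
    delta u v w - delta u v' w' =
      u ⬝ᵥ ((2 : F) • (v' + w' - v - w)) + 2 * (v ⬝ᵥ w - v' ⬝ᵥ w') := by
  simp only [delta, dotProduct, Fin.sum_univ_two, Pi.smul_apply, Pi.add_apply, Pi.sub_apply,
    smul_eq_mul]
  ring

variable [Fintype F]

lemma FiniteField.two_ne_zero_of_odd_card (hq : Odd (Fintype.card F)) : (2 : F) ≠ 0 := by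
  refine Ring.two_ne_zero fun h => ?_
  have := FiniteField.even_card_of_char_two h
  rw [Nat.odd_iff] at hq
  omega

open Classical in
/-- Orthogonality of the additive characters `u ↦ ψ (u ⬝ᵥ s)`. -/
lemma AddChar.sum_dotProduct_eq_ite {n : ℕ} {ψ : AddChar F ℂ} (hψ : ψ ≠ 1) (s : Fin n → F) :
    ∑ u : Fin n → F, ψ (u ⬝ᵥ s) = if s = 0 then (Fintype.card F : ℂ) ^ n else 0 := by
  let L : (Fin n → F) →+ F := AddMonoidHom.mk' (fun u => u ⬝ᵥ s) fun a b => add_dotProduct a b s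
  have h := AddChar.sum_eq_ite (ψ.compAddMonoidHom L)
  have hL : ψ.compAddMonoidHom L = 0 ↔ s = 0 := by
    constructor
    · intro h0
      by_contra hs
      obtain ⟨i, hi⟩ := Function.ne_iff.mp hs
      refine hψ (DFunLike.ext _ _ fun a => ?_)
      have := DFunLike.congr_fun h0 (Pi.single i (a / s i))
      simpa [L, div_mul_cancel₀ a hi] using this
    · rintro rfl
      ext u
      simp [L]
  simpa [hL, L] using h

open Classical in
/-- Second moment over `u` of the exponential sum with phase `delta u v w`, `(v, w) ∈ P`. -/
lemma sum_norm_sq_sum_delta (h2 : (2 : F) ≠ 0) {ψ : AddChar F ℂ} (hψ : ψ ≠ 1)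
    (P : Finset ((Fin 2 → F) × (Fin 2 → F))) :
    ((∑ u : Fin 2 → F, ‖∑ p ∈ P, ψ (delta u p.1 p.2)‖ ^ 2 : ℝ) : ℂ) =
      (Fintype.card F : ℂ) ^ 2 * ∑ x ∈ (P ×ˢ P).filter (fun x => x.1.1 + x.1.2 = x.2.1 + x.2.2),
        ψ (2 * (x.1.1 ⬝ᵥ x.1.2 - x.2.1 ⬝ᵥ x.2.2)) := by
  push_cast
  calc ∑ u : Fin 2 → F, (‖∑ p ∈ P, ψ (delta u p.1 p.2)‖ : ℂ) ^ 2
      = ∑ u : Fin 2 → F, ∑ x ∈ P ×ˢ P, ψ (u ⬝ᵥ ((2 : F) • (x.2.1 + x.2.2 - x.1.1 - x.1.2))) *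
          ψ (2 * (x.1.1 ⬝ᵥ x.1.2 - x.2.1 ⬝ᵥ x.2.2)) := by
        refine sum_congr rfl fun u _ => ?_
        rw [← Complex.mul_conj', map_sum, sum_mul_sum, sum_product]
        refine sum_congr rfl fun p _ => sum_congr rfl fun p' _ => ?_
        rw [← AddChar.map_neg_eq_conj, ← AddChar.map_add_eq_mul, ← AddChar.map_add_eq_mul,
          ← sub_eq_add_neg, delta_sub_delta]
    _ = _ := by
        rw [sum_comm, sum_filter, mul_sum]
        refine sum_congr rfl fun x _ => ?_
        rw [← sum_mul, AddChar.sum_dotProduct_eq_ite hψ]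
        have : (2 : F) • (x.2.1 + x.2.2 - x.1.1 - x.1.2) = 0 ↔
            x.1.1 + x.1.2 = x.2.1 + x.2.2 := by
          rw [smul_eq_zero_iff_right h2, sub_sub, sub_eq_zero, eq_comm]
        simp only [this]
        split_ifs <;> simp

open Classical in
/-- A circle in the plane over `F` has at most `2q` points. -/
lemma card_filter_dotProduct_sub_eq_le (s : Fin 2 → F) (c : F) :
    #{x : Fin 2 → F | x ⬝ᵥ (s - x) = c} ≤ 2 * Fintype.card F := by
  refine (card_le_mul_card_image (f := fun x : Fin 2 → F => x 0) _ 2 fun a _ => ?_).trans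
    (Nat.mul_le_mul_left 2 (card_le_univ _))
  by_contra! h
  obtain ⟨x, y, z, hx, hy, hz, hxy, hxz, hyz⟩ := two_lt_card_iff.mp h
  simp only [mem_filter, mem_univ, true_and, dotProduct, Fin.sum_univ_two, Pi.sub_apply]
    at hx hy hz
  have key : ∀ {x y : Fin 2 → F}, x 0 = a → y 0 = a → x ≠ y → x 1 ≠ y 1 := by
    intro x y hx hy hxy h1
    exact hxy (funext fun i => by fin_cases i <;> simp_all)
  have hs : ∀ {x y : Fin 2 → F},
      (x 0 * (s 0 - x 0) + x 1 * (s 1 - x 1) = c ∧ x 0 = a) →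
      (y 0 * (s 0 - y 0) + y 1 * (s 1 - y 1) = c ∧ y 0 = a) → x ≠ y → x 1 + y 1 = s 1 := by
    rintro x y ⟨hx, hx0⟩ ⟨hy, hy0⟩ hxy
    rw [hx0] at hx
    rw [hy0] at hy
    refine mul_left_cancel₀ (sub_ne_zero.mpr (key hx0 hy0 hxy)) ?_
    linear_combination hy - hx
  exact key hy.2 hz.2 hyz (add_left_cancel ((hs hx hy hxy).trans (hs hx hz hxz).symm))

open Classical in
/-- The number of rectangles (possibly degenerate) with vertices in `Z`, given by their
diagonals. -/
lemma card_rectangles_le (Z : Finset (Fin 2 → F)) :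
    #{x ∈ (Z ×ˢ Z) ×ˢ (Z ×ˢ Z) | x.1.1 + x.1.2 = x.2.1 + x.2.2 ∧
        x.1.1 ⬝ᵥ x.1.2 = x.2.1 ⬝ᵥ x.2.2} ≤ 2 * Fintype.card F * #Z ^ 2 := by
  rw [sq, ← card_product]
  refine card_le_mul_card_image_of_maps_to (f := Prod.fst)
    (fun x hx => (mem_product.mp (mem_filter.mp hx).1).1) _ fun p _ => ?_
  refine le_trans (card_le_card_of_injOn (fun x => x.2.1) ?_ ?_)
    (card_filter_dotProduct_sub_eq_le (p.1 + p.2) (p.1 ⬝ᵥ p.2))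
  · rintro ⟨_, v, w⟩ hx
    simp only [coe_filter, mem_filter, Set.mem_ofPred_eq] at hx ⊢
    obtain ⟨⟨_, hs, hd⟩, rfl⟩ := hx
    simp [hs, hd]
  · rintro ⟨_, v, w⟩ hx ⟨_, v', w'⟩ hy h
    simp only [coe_filter, mem_filter, Set.mem_ofPred_eq] at hx hy h
    obtain ⟨⟨_, hs, _⟩, rfl⟩ := hx
    obtain ⟨⟨_, hs', _⟩, rfl⟩ := hy
    subst h
    simp_all

open Classical in
/-- Second moment over `u` and over the nontrivial characters. -/
lemma sum_sum_norm_sq_sum_delta_le (h2 : (2 : F) ≠ 0) (Z : Finset (Fin 2 → F)) :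
    ∑ ψ ∈ (univ : Finset (AddChar F ℂ)).filter (· ≠ 1),
        ∑ u : Fin 2 → F, ‖∑ p ∈ Z ×ˢ Z, ψ (delta u p.1 p.2)‖ ^ 2 ≤
      2 * (#Z : ℝ) ^ 2 * (Fintype.card F : ℝ) ^ 4 := by
  set Q := ((Z ×ˢ Z) ×ˢ (Z ×ˢ Z)).filter (fun x => x.1.1 + x.1.2 = x.2.1 + x.2.2) with hQ
  set N := #{x ∈ Q | x.1.1 ⬝ᵥ x.1.2 = x.2.1 ⬝ᵥ x.2.2} with hN
  have hle : N ≤ 2 * Fintype.card F * #Z ^ 2 := by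
    rw [hN, hQ, filter_filter]
    exact card_rectangles_le Z
  have hall : ∑ ψ : AddChar F ℂ, ∑ x ∈ Q, ψ (2 * (x.1.1 ⬝ᵥ x.1.2 - x.2.1 ⬝ᵥ x.2.2)) =
      (Fintype.card F : ℂ) * N := by
    rw [sum_comm]
    simp only [AddChar.sum_apply_eq_ite, mul_eq_zero, h2, false_or, sub_eq_zero]
    rw [← sum_filter, sum_const, nsmul_eq_mul, mul_comm]
  have heq : ∑ ψ ∈ (univ : Finset (AddChar F ℂ)).filter (· ≠ 1),
      ∑ u : Fin 2 → F, ‖∑ p ∈ Z ×ˢ Z, ψ (delta u p.1 p.2)‖ ^ 2 =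
      (Fintype.card F : ℝ) ^ 2 * (Fintype.card F * N - #Q) := by
    rw [← Complex.ofReal_inj, Complex.ofReal_sum]
    rw [sum_congr rfl fun ψ hψ =>
      sum_norm_sq_sum_delta h2 (mem_filter.mp hψ).2 (Z ×ˢ Z), ← mul_sum]
    rw [← sum_filter_add_sum_filter_not univ (· ≠ (1 : AddChar F ℂ))] at hall
    have h1 : (univ.filter fun ψ : AddChar F ℂ => ¬ ψ ≠ 1) = {1} := by ext; simp
    rw [h1, sum_singleton] at hall
    simp only [AddChar.one_apply, sum_const, nsmul_eq_mul, mul_one] at hall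
    push_cast
    rw [← hall]
    ring
  rw [heq]
  have hle' : (N : ℝ) ≤ 2 * Fintype.card F * #Z ^ 2 := by exact_mod_cast hle
  calc (Fintype.card F : ℝ) ^ 2 * (Fintype.card F * N - #Q)
      ≤ (Fintype.card F : ℝ) ^ 2 * (Fintype.card F * (2 * Fintype.card F * #Z ^ 2)) := by
        gcongr
        have : (0 : ℝ) ≤ #Q := by positivity
        have : (Fintype.card F : ℝ) * N ≤ Fintype.card F * (2 * Fintype.card F * #Z ^ 2) := by
          gcongr
        linarith
    _ = _ := by ring

end

open Classical in
/-- For `Z ⊆ F_q²`, the sum `R = Σ_{ψ ≠ 1} |S_ψ(Z)|` over the nontrivial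
additive characters of `F_q` satisfies `R² ≤ 2·(#Z)³·q⁵`. -/
theorem sum_norm_S_sq_le {F : Type*} [Field F] [Fintype F]
    (hq : Odd (Fintype.card F)) (Z : Finset (Fin 2 → F)) :
    (∑ ψ ∈ (Finset.univ : Finset (AddChar F ℂ)).filter (· ≠ 1),
        ‖∑ u ∈ Z, ∑ v ∈ Z, ∑ w ∈ Z, ψ (delta u v w)‖) ^ 2 ≤
      2 * (Z.card : ℝ) ^ 3 * (Fintype.card F : ℝ) ^ 5 := by
  have h2 := FiniteField.two_ne_zero_of_odd_card hq
  have hcard : #((univ : Finset (AddChar F ℂ)).filter (· ≠ 1)) ≤ Fintype.card F :=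
    (card_le_univ _).trans AddChar.card_eq.le
  have hS : ∀ ψ : AddChar F ℂ, ‖∑ u ∈ Z, ∑ v ∈ Z, ∑ w ∈ Z, ψ (delta u v w)‖ ^ 2 ≤
      #Z * ∑ u : Fin 2 → F, ‖∑ p ∈ Z ×ˢ Z, ψ (delta u p.1 p.2)‖ ^ 2 := by
    intro ψ
    simp_rw [← sum_product' Z Z (fun v w => ψ (delta _ v w))]
    calc _ ≤ (∑ u ∈ Z, ‖∑ p ∈ Z ×ˢ Z, ψ (delta u p.1 p.2)‖) ^ 2 := by
          gcongr
          exact norm_sum_le _ _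
      _ ≤ #Z * ∑ u ∈ Z, ‖∑ p ∈ Z ×ˢ Z, ψ (delta u p.1 p.2)‖ ^ 2 := sq_sum_le_card_mul_sum_sq
      _ ≤ _ := by
          gcongr
          exact subset_univ Z
  refine sq_sum_le_card_mul_sum_sq.trans ?_
  calc _ ≤ (Fintype.card F : ℝ) * ∑ ψ ∈ (univ : Finset (AddChar F ℂ)).filter (· ≠ 1),
          #Z * ∑ u : Fin 2 → F, ‖∑ p ∈ Z ×ˢ Z, ψ (delta u p.1 p.2)‖ ^ 2 := by
        gcongr with ψ
        exact hS ψ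
    _ ≤ (Fintype.card F : ℝ) * (#Z * (2 * (#Z : ℝ) ^ 2 * (Fintype.card F : ℝ) ^ 4)) := by
        rw [← mul_sum]
        gcongr
        exact sum_sum_norm_sq_sum_delta_le h2 Z
    _ = _ := by ring
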